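/- Let 3 ≤ k < t be integers and 0 < γ < β(k,t). Then there exist an integer n₀ = n₀(k,t,γ) and a constant ε₀ = ε₀(k,t,γ) > 0 such that the following holds: for every k-graph H on n ≥ n₀ vertices with δ_{k−1}(H) ≥ (1 − β(k,t) + γ)·n and every partition of V(H) into sets X and Y with |X| ≥ (d(k,t)+γ)·n and |Y| ≥ (d(k,t)+γ)·n, there exist at least ε₀·n^{t+1} triples (x, y, T) with x ∈ X, y ∈ Y and T a (t−1)-set of vertices of H not containing x or y, such that both T ∪ {x} and T ∪ {y} form copies of K_t^k in H. -/

import Mathlib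

open Finset

/-- `A` is the vertex set of a copy of the hypergraph with vertex type `V` and edge set `EF`
inside the hypergraph on `Fin n` with edge set `E`. -/
def IsCopy {n : ℕ} {V : Type} [Fintype V] [DecidableEq V] (E : Finset (Finset (Fin n)))
    (EF : Finset (Finset V)) (A : Finset (Fin n)) : Prop :=
  ∃ f : V ↪ Fin n, Finset.map f Finset.univ = A ∧ ∀ e ∈ EF, e.map f ∈ E

/-- The induced subhypergraph of `E` on `S` has an `F`-factor, where `F` has vertex type `V`
and edge set `EF`: there are pairwise vertex-disjoint copies of `F` covering exactly `S`. -/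
def HasFactorOn {n : ℕ} {V : Type} [Fintype V] [DecidableEq V] (E : Finset (Finset (Fin n)))
    (EF : Finset (Finset V)) (S : Finset (Fin n)) : Prop :=
  ∃ P : Finset (Finset (Fin n)), (∀ A ∈ P, IsCopy E EF A) ∧
    (P : Set (Finset (Fin n))).PairwiseDisjoint id ∧ P.biUnion id = S

/-- `x` is `(F, i, η)`-close to `y`. -/
def CloseTo {n : ℕ} {V : Type} [Fintype V] [DecidableEq V] (E : Finset (Finset (Fin n)))
    (EF : Finset (Finset V)) (i : ℕ) (η : ℝ) (x y : Fin n) : Prop :=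
  η * (n : ℝ) ^ (i * Fintype.card V - 1) ≤
    (({S : Finset (Fin n) | S.card = i * Fintype.card V - 1 ∧ x ∉ S ∧ y ∉ S ∧
      HasFactorOn E EF (insert x S) ∧ HasFactorOn E EF (insert y S)}).ncard : ℝ)

/-- `H` is `(F, i, η)`-closed. -/
def IsClosedGraph {n : ℕ} {V : Type} [Fintype V] [DecidableEq V] (E : Finset (Finset (Fin n)))
    (EF : Finset (Finset V)) (i : ℕ) (η : ℝ) : Prop :=
  ∀ x y : Fin n, x ≠ y → CloseTo E EF i η x y

/-- `Ñ_{F,i,η}(x)`: the set of vertices `(F, i, η)`-close to `x`. -/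
def Ntilde {n : ℕ} {V : Type} [Fintype V] [DecidableEq V] (E : Finset (Finset (Fin n)))
    (EF : Finset (Finset V)) (i : ℕ) (η : ℝ) (x : Fin n) : Set (Fin n) :=
  {y | CloseTo E EF i η x y}

/-- Degree of the set `T` in the `k`-graph with edge set `E`. -/
noncomputable def degOn {n : ℕ} (E : Finset (Finset (Fin n))) (k : ℕ) (T : Finset (Fin n)) : ℕ :=
  ({S : Finset (Fin n) | S.card = k - T.card ∧ Disjoint S T ∧ S ∪ T ∈ E}).ncard

/-- Edge set of the complete `k`-graph `K_t^k` on `Fin t`. -/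
def cliqueEdges (t k : ℕ) : Finset (Finset (Fin t)) :=
  Finset.powersetCard k (Finset.univ : Finset (Fin t))

/-- Edge set of the complete `k`-partite `k`-graph `K_k^k(m)` with parts of size `m`. -/
def multipartiteEdges (k m : ℕ) : Finset (Finset (Fin k × Fin m)) :=
  Finset.univ.filter (fun e : Finset (Fin k × Fin m) =>
    ∀ i : Fin k, (e.filter (fun v => v.1 = i)).card = 1)

/-- `β(k,t,l)` from the paper. -/
noncomputable def betaL (k t l : ℕ) : ℝ :=
  2 / ((t.choose (k - 1) : ℝ) + ((t - l - 1).choose (k - 1) : ℝ) + ((l + 1).choose (k - 1) : ℝ))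

/-- The defining conditions for `l₀(k,t)` when `k ≥ 4`. -/
def GoodL (k t l : ℕ) : Prop :=
  2 * (l + 1) ≤ t ∧
  betaL k t l ≤ 1 / (((t - 1).choose (k - 1) : ℝ) + (l.choose (k - 1) : ℝ)) ∧
  (0 < (2 * l + 1).choose (k - 1) →
    betaL k t l ≤ 1 / (2 * ((2 * l + 1).choose (k - 1) : ℝ)))

/-- `l₀(k,t)`: equal to `1` when `k = 3`, and the largest `l` satisfying `GoodL k t l`
when `k ≥ 4`. -/
noncomputable def l0 (k t : ℕ) : ℕ := if k = 3 then 1 else sSup {l | GoodL k t l}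

/-- `β(k,t) = β(k,t,l₀(k,t))`. -/
noncomputable def betaKT (k t : ℕ) : ℝ := betaL k t (l0 k t)

/-- `d(k,t) = 1 - C(t-1,k-1)·β(k,t)`. -/
noncomputable def dKT (k t : ℕ) : ℝ := 1 - ((t - 1).choose (k - 1) : ℝ) * betaKT k t

/-- `S` spans a complete `k`-graph in `E`: every `k`-subset of `S` is an edge. -/
def IsKClique {n : ℕ} (E : Finset (Finset (Fin n))) (k : ℕ) (S : Finset (Fin n)) : Prop :=
  ∀ e ∈ Finset.powersetCard k S, e ∈ E

/-- The vertices `v ∉ S` that can replace a vertex of `S` in the other part so that the result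
is again a clique. -/
noncomputable def swaps {n : ℕ} (E : Finset (Finset (Fin n))) (k : ℕ) (X Y S : Finset (Fin n)) :
    Finset (Fin n) :=
  open scoped Classical in
  Finset.univ.filter fun v => v ∉ S ∧ ∃ u ∈ S, ((v ∈ X ∧ u ∈ Y) ∨ (v ∈ Y ∧ u ∈ X)) ∧
    IsKClique E k (insert v (S.erase u))

lemma swaps_comm {n : ℕ} (E : Finset (Finset (Fin n))) (k : ℕ) (X Y S : Finset (Fin n)) :
    swaps E k X Y S = swaps E k Y X S := by
  unfold swaps
  congr! 6
  rw [or_comm]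

/-- The `(k-1)`-subsets of `S` that do not form an edge together with `v`. -/
def missing {n : ℕ} (E : Finset (Finset (Fin n))) (k : ℕ) (S : Finset (Fin n)) (v : Fin n) :
    Finset (Finset (Fin n)) :=
  {B ∈ Finset.powersetCard (k - 1) S | insert v B ∉ E}

lemma card_nonneighbors_add_degOn_le {n k : ℕ} (hk : 1 ≤ k) (E : Finset (Finset (Fin n)))
    (T : Finset (Fin n)) (hT : T.card = k - 1) :
    #{v : Fin n | insert v T ∉ E} + degOn E k T ≤ n := by
  have h : degOn E k T ≤ #{v : Fin n | insert v T ∈ E} := by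
    rw [degOn, ← Finset.card_image_of_injective {v | insert v T ∈ E}
      (Finset.singleton_injective (α := Fin n)), ← Set.ncard_coe_finset (Finset.image _ _)]
    refine Set.ncard_le_ncard ?_ (Finset.finite_toSet _)
    rintro S ⟨h1, -, h3⟩
    have : S.card = 1 := by omega
    obtain ⟨v, rfl⟩ := Finset.card_eq_one.1 this
    refine Finset.mem_coe.2 (Finset.mem_image_of_mem _
      (Finset.mem_filter.2 ⟨Finset.mem_univ v, ?_⟩))
    rwa [Finset.insert_eq]
  have h2 := Finset.card_filter_add_card_filter_not (s := (Finset.univ : Finset (Fin n)))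
    (fun v => insert v T ∈ E)
  rw [Finset.card_univ, Fintype.card_fin] at h2
  omega

lemma sum_missing_le {n k : ℕ} {E : Finset (Finset (Fin n))} {δ : ℝ}
    (hdeg : ∀ T : Finset (Fin n), T.card = k - 1 → (#{v : Fin n | insert v T ∉ E} : ℝ) ≤ δ * n)
    (S : Finset (Fin n)) (w : Finset (Fin n) → ℝ) (hw : ∀ B, 0 ≤ w B) :
    ∑ v, ∑ B ∈ missing E k S v, w B ≤ δ * n * ∑ B ∈ Finset.powersetCard (k - 1) S, w B := by
  simp only [missing, Finset.sum_filter]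
  rw [Finset.sum_comm, Finset.mul_sum]
  refine Finset.sum_le_sum fun B hB => ?_
  rw [← Finset.sum_filter, Finset.sum_const, nsmul_eq_mul]
  exact mul_le_mul_of_nonneg_right (hdeg B (Finset.mem_powersetCard.1 hB).2) (hw B)

lemma IsKClique.mono {n k : ℕ} {E : Finset (Finset (Fin n))} {A B : Finset (Fin n)}
    (hB : IsKClique E k B) (h : A ⊆ B) : IsKClique E k A :=
  fun e he => hB e (Finset.powersetCard_mono h he)

lemma IsKClique.insert {n k : ℕ} {E : Finset (Finset (Fin n))} {A : Finset (Fin n)}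
    {v : Fin n} (hA : IsKClique E k A) (h : missing E k A v = ∅) :
    IsKClique E k (insert v A) := by
  intro e he
  rw [Finset.mem_powersetCard] at he
  by_cases hv : v ∈ e
  · have h1 : e.erase v ∈ Finset.powersetCard (k - 1) A := by
      rw [Finset.mem_powersetCard, Finset.card_erase_of_mem hv, he.2]
      exact ⟨Finset.subset_insert_iff.1 he.1, rfl⟩
    have h2 := Finset.filter_eq_empty_iff.1 h h1
    rw [Finset.insert_erase hv] at h2
    exact not_not.1 h2
  · exact hA e (Finset.mem_powersetCard.2 ⟨(Finset.subset_insert_iff_of_notMem hv).1 he.1, he.2⟩)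

lemma exists_missing_of_notMem_swaps {n k : ℕ} {E : Finset (Finset (Fin n))}
    {X Y S : Finset (Fin n)} (hS : IsKClique E k S) {v u : Fin n} (hv : v ∉ S)
    (hv' : v ∉ swaps E k X Y S) (hu : u ∈ S) (huv : (v ∈ X ∧ u ∈ Y) ∨ (v ∈ Y ∧ u ∈ X)) :
    ∃ B ∈ missing E k S v, u ∉ B := by
  by_contra! h
  refine hv' ?_
  simp only [swaps, Finset.mem_filter, Finset.mem_univ, true_and]
  refine ⟨hv, u, hu, huv, (hS.mono (Finset.erase_subset u S)).insert ?_⟩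
  refine Finset.eq_empty_of_forall_notMem fun B hB => ?_
  simp only [missing, Finset.mem_filter, Finset.mem_powersetCard] at hB
  refine absurd (h B ?_) fun hh => Finset.notMem_erase u S (hB.1.1 hh)
  simp only [missing, Finset.mem_filter, Finset.mem_powersetCard]
  exact ⟨⟨hB.1.1.trans (Finset.erase_subset u S), hB.1.2⟩, hB.2⟩

/-- If every vertex of `S ∩ Z` is avoided by a set missing at `v`, then the sets missing at `v`
have total weight at least `2`, provided sets disjoint from `Z` have weight at least `2`. -/
lemma two_le_sum_missing {n k : ℕ} {E : Finset (Finset (Fin n))}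
    {S Z : Finset (Fin n)} {v : Fin n} (hne : (S ∩ Z).Nonempty)
    (h : ∀ u ∈ S ∩ Z, ∃ B ∈ missing E k S v, u ∉ B)
    (w : Finset (Fin n) → ℝ) (hw : ∀ B, 1 ≤ w B)
    (hw2 : ∀ B ∈ Finset.powersetCard (k - 1) S, Disjoint B Z → 2 ≤ w B) :
    2 ≤ ∑ B ∈ missing E k S v, w B := by
  obtain ⟨u, hu⟩ := hne
  obtain ⟨B, hB, -⟩ := h u hu
  have hBS := (Finset.mem_filter.1 hB).1
  have hpos : ∀ B, 0 ≤ w B := fun B => zero_le_one.trans (hw B)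
  by_cases hd : Disjoint B Z
  · exact (hw2 B hBS hd).trans (Finset.single_le_sum (fun B _ => hpos B) hB)
  · obtain ⟨a, haB, haZ⟩ := Finset.not_disjoint_iff.1 hd
    obtain ⟨B', hB', haB'⟩ := h a
      (Finset.mem_inter.2 ⟨(Finset.mem_powersetCard.1 hBS).1 haB, haZ⟩)
    have hne : B ≠ B' := by rintro rfl; exact haB' haB
    calc (2 : ℝ) ≤ w B + w B' := by linarith [hw B, hw B']
      _ = ∑ C ∈ {B, B'}, w C := (Finset.sum_pair hne).symm
      _ ≤ _ := Finset.sum_le_sum_of_subset_of_nonneg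
        (by simp [Finset.insert_subset_iff, hB, hB']) fun B _ _ => hpos B

lemma le_card_swaps {n k : ℕ} {E : Finset (Finset (Fin n))} {δ : ℝ}
    (hdeg : ∀ T : Finset (Fin n), T.card = k - 1 → (#{v : Fin n | insert v T ∉ E} : ℝ) ≤ δ * n)
    (X Y S : Finset (Fin n)) (w : Finset (Fin n) → ℝ) (hw : ∀ B, 0 ≤ w B)
    (c : Fin n → ℝ) (hc2 : ∀ v, c v ≤ 2)
    (hc : ∀ v, v ∉ S → v ∉ swaps E k X Y S → c v ≤ ∑ B ∈ missing E k S v, w B) :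
    ∑ v, c v - 2 * S.card - δ * n * ∑ B ∈ Finset.powersetCard (k - 1) S, w B
      ≤ 2 * (swaps E k X Y S).card := by
  have h1 := sum_missing_le hdeg S w hw
  have h2 : ∑ v, c v ≤ ∑ v, (∑ B ∈ missing E k S v, w B +
      if v ∈ S ∪ swaps E k X Y S then 2 else 0) := by
    refine Finset.sum_le_sum fun v _ => ?_
    split_ifs with h
    · have : 0 ≤ ∑ B ∈ missing E k S v, w B := Finset.sum_nonneg fun B _ => hw B
      linarith [hc2 v]
    · rw [Finset.mem_union, not_or] at h
      linarith [hc v h.1 h.2]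
  rw [Finset.sum_add_distrib, ← Finset.sum_filter, Finset.sum_const, nsmul_eq_mul] at h2
  have h3 : (#{v | v ∈ S ∪ swaps E k X Y S} : ℝ) ≤ S.card + (swaps E k X Y S).card := by
    rw [Finset.filter_univ_mem]
    exact_mod_cast Finset.card_union_le _ _
  linarith

lemma choose_add_choose_le (r m M d : ℕ) (h : m ≤ M) :
    (m + d).choose r + M.choose r ≤ m.choose r + (M + d).choose r := by
  induction d with
  | zero => simp
  | succ d ih =>
    cases r with
    | zero => simp
    | succ r =>
      have : (m + d).choose r ≤ (M + d).choose r := Nat.choose_le_choose r (by omega)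
      rw [← add_assoc, ← add_assoc, Nat.choose_succ_succ (m + d), Nat.choose_succ_succ (M + d)]
      simp only [Nat.succ_eq_add_one] at *
      omega

/-- A clique meeting both parts in at least `m` vertices has many swaps. -/
lemma le_card_swaps_of_balanced {n k : ℕ} {E : Finset (Finset (Fin n))} {δ : ℝ} (hδ : 0 ≤ δ)
    (hdeg : ∀ T : Finset (Fin n), T.card = k - 1 → (#{v : Fin n | insert v T ∉ E} : ℝ) ≤ δ * n)
    {X Y : Finset (Fin n)} (hXY : Disjoint X Y) (hun : X ∪ Y = Finset.univ)
    {S : Finset (Fin n)} (hS : IsKClique E k S) {m : ℕ} (hm : 1 ≤ m)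
    (hX : m ≤ (S ∩ X).card) (hY : m ≤ (S ∩ Y).card) :
    2 * (n : ℝ) - 2 * S.card - δ * n * ((S.card.choose (k - 1) : ℝ) +
      ((S.card - m).choose (k - 1) : ℝ) + (m.choose (k - 1) : ℝ))
      ≤ 2 * (swaps E k X Y S).card := by
  have hcard : (S ∩ X).card + (S ∩ Y).card = S.card := by
    rw [← Finset.card_union_of_disjoint
      (hXY.mono Finset.inter_subset_right Finset.inter_subset_right),
      ← Finset.inter_union_distrib_left, hun, Finset.inter_univ]
  have hmem : ∀ v, v ∈ X ∨ v ∈ Y := fun v => by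
    rw [← Finset.mem_union, hun]; exact Finset.mem_univ v
  let w : Finset (Fin n) → ℝ := fun B =>
    1 + (if B ⊆ S ∩ X then 1 else 0) + (if B ⊆ S ∩ Y then 1 else 0)
  have hw1 : ∀ B, 1 ≤ w B := fun B => by
    simp only [w]; split_ifs <;> norm_num
  have hsub : ∀ B, B ∈ Finset.powersetCard (k - 1) S → ∀ P Q : Finset (Fin n),
      (∀ v, v ∈ P ∨ v ∈ Q) → Disjoint B Q → B ⊆ S ∩ P := by
    intro B hB P Q hPQ hd b hb
    exact Finset.mem_inter.2 ⟨(Finset.mem_powersetCard.1 hB).1 hb,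
      (hPQ b).resolve_right fun hq => Finset.disjoint_left.1 hd hb hq⟩
  have key := le_card_swaps hdeg X Y S w (fun B => zero_le_one.trans (hw1 B)) (fun _ => 2)
    (fun _ => le_rfl) (fun v hvS hv => by
      rcases hmem v with hvX | hvY
      · refine two_le_sum_missing (Z := Y) (Finset.card_pos.1 (by omega))
          (fun u hu => exists_missing_of_notMem_swaps hS hvS hv (Finset.mem_inter.1 hu).1
            (Or.inl ⟨hvX, (Finset.mem_inter.1 hu).2⟩)) w hw1 fun B hB hd => ?_
        have := hsub B hB X Y hmem hd
        simp only [w, if_pos this]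
        split_ifs <;> norm_num
      · refine two_le_sum_missing (Z := X) (Finset.card_pos.1 (by omega))
          (fun u hu => exists_missing_of_notMem_swaps hS hvS hv (Finset.mem_inter.1 hu).1
            (Or.inr ⟨hvY, (Finset.mem_inter.1 hu).2⟩)) w hw1 fun B hB hd => ?_
        have := hsub B hB Y X (fun v => (hmem v).symm) hd
        simp only [w, if_pos this]
        split_ifs <;> norm_num)
  have hfil : ∀ P : Finset (Fin n), ∑ B ∈ Finset.powersetCard (k - 1) S,
      (if B ⊆ S ∩ P then (1 : ℝ) else 0) = ((S ∩ P).card.choose (k - 1) : ℝ) := by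
    intro P
    rw [← Finset.sum_filter, Finset.sum_const, nsmul_eq_mul, mul_one, ← Finset.card_powersetCard]
    congr 2
    ext B
    simp only [Finset.mem_filter, Finset.mem_powersetCard]
    exact ⟨fun h => ⟨h.2, h.1.2⟩, fun h => ⟨⟨h.1.trans Finset.inter_subset_left, h.2⟩, h.1⟩⟩
  have hW : ∑ B ∈ Finset.powersetCard (k - 1) S, w B ≤ (S.card.choose (k - 1) : ℝ) +
      ((S.card - m).choose (k - 1) : ℝ) + (m.choose (k - 1) : ℝ) := by
    simp only [w, Finset.sum_add_distrib, hfil, Finset.sum_const, Finset.card_powersetCard,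
      nsmul_eq_mul, mul_one]
    have := choose_add_choose_le (k - 1) m (S ∩ Y).card ((S ∩ X).card - m) hY
    rw [Nat.add_sub_cancel' hX,
      show (S ∩ Y).card + ((S ∩ X).card - m) = S.card - m by omega] at this
    have : (((S ∩ X).card.choose (k - 1) : ℝ) + ((S ∩ Y).card.choose (k - 1) : ℝ)) ≤
      (m.choose (k - 1) : ℝ) + ((S.card - m).choose (k - 1) : ℝ) := by exact_mod_cast this
    linarith
  have := mul_le_mul_of_nonneg_left hW (mul_nonneg hδ (Nat.cast_nonneg n))
  simp only [Finset.sum_const, Finset.card_univ, Fintype.card_fin, nsmul_eq_mul] at key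
  linarith

/-- A `4`-clique meeting the part `Q` in exactly one vertex has many swaps. -/
lemma le_card_swaps_of_inter_eq_one {n : ℕ} {E : Finset (Finset (Fin n))} {δ : ℝ}
    (hdeg : ∀ T : Finset (Fin n), T.card = 3 - 1 → (#{v : Fin n | insert v T ∉ E} : ℝ) ≤ δ * n)
    {P Q : Finset (Fin n)} (hun : P ∪ Q = Finset.univ)
    {S : Finset (Fin n)} (hS : IsKClique E 3 S) (hcard : S.card = 4)
    (hP : (S ∩ P).Nonempty) (hQ : (S ∩ Q).card = 1) :
    (n : ℝ) + Q.card - 8 - δ * n * 6 ≤ 2 * (swaps E 3 P Q S).card := by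
  have hmem : ∀ v, v ∈ P ∨ v ∈ Q := fun v => by
    rw [← Finset.mem_union, hun]; exact Finset.mem_univ v
  have key := le_card_swaps hdeg P Q S (fun _ => 1) (fun _ => zero_le_one)
    (fun v => 1 + if v ∈ Q then 1 else 0) (fun v => by split_ifs <;> norm_num) (fun v hvS hv => by
      split_ifs with hvQ
      · rw [one_add_one_eq_two]
        refine two_le_sum_missing (Z := P) hP
          (fun u hu => exists_missing_of_notMem_swaps hS hvS hv (Finset.mem_inter.1 hu).1
            (Or.inr ⟨hvQ, (Finset.mem_inter.1 hu).2⟩)) _ (fun _ => le_rfl) fun B hB hd => ?_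
        rw [Finset.mem_powersetCard] at hB
        have : B ⊆ S ∩ Q := fun b hb => Finset.mem_inter.2 ⟨hB.1 hb,
          (hmem b).resolve_left fun hq => Finset.disjoint_left.1 hd hb hq⟩
        have := Finset.card_le_card this
        omega
      · obtain ⟨u, hu⟩ : (S ∩ Q).Nonempty := Finset.card_pos.1 (by omega)
        rw [Finset.mem_inter] at hu
        obtain ⟨B, hB, -⟩ := exists_missing_of_notMem_swaps hS hvS hv hu.1
          (Or.inl ⟨(hmem v).resolve_right hvQ, hu.2⟩)
        rw [add_zero]
        exact Finset.single_le_sum (f := fun _ => (1 : ℝ)) (fun _ _ => zero_le_one) hB)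
  simp only [Finset.sum_add_distrib, Finset.sum_const, Finset.card_univ, Fintype.card_fin,
    nsmul_eq_mul, mul_one, ← Finset.sum_filter, Finset.filter_univ_mem, hcard,
    Finset.card_powersetCard, show Nat.choose 4 (3 - 1) = 6 from rfl] at key
  push_cast at key
  linarith

open scoped Classical in
lemma le_card_extensions {n k : ℕ} {E : Finset (Finset (Fin n))} {δ : ℝ}
    (hdeg : ∀ T : Finset (Fin n), T.card = k - 1 → (#{v : Fin n | insert v T ∉ E} : ℝ) ≤ δ * n)
    {A : Finset (Fin n)} (hA : IsKClique E k A) (Z : Finset (Fin n)) :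
    (Z.card : ℝ) - A.card.choose (k - 1) * (δ * n) - A.card ≤
      (#{v ∈ Z | v ∉ A ∧ IsKClique E k (insert v A)} : ℝ) := by
  have hsub : Z ⊆ {v ∈ Z | v ∉ A ∧ IsKClique E k (insert v A)} ∪ (A ∪
      (Finset.powersetCard (k - 1) A).biUnion fun B => {v : Fin n | insert v B ∉ E}) := by
    intro v hv
    by_cases hvA : v ∈ A
    · simp [hvA]
    by_cases hm : missing E k A v = ∅
    · exact Finset.mem_union_left _ (Finset.mem_filter.2 ⟨hv, hvA, hA.insert hm⟩)
    · obtain ⟨B, hB⟩ := Finset.nonempty_of_ne_empty hm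
      rw [missing, Finset.mem_filter] at hB
      refine Finset.mem_union_right _ (Finset.mem_union_right _ (Finset.mem_biUnion.2
        ⟨B, hB.1, ?_⟩))
      simpa using hB.2
  have h1 := (Finset.card_le_card hsub).trans ((Finset.card_union_le _ _).trans
    (Nat.add_le_add_left ((Finset.card_union_le _ _).trans
      (Nat.add_le_add_left Finset.card_biUnion_le _)) _))
  have h2 : ∑ B ∈ Finset.powersetCard (k - 1) A, (#{v : Fin n | insert v B ∉ E} : ℝ) ≤
      A.card.choose (k - 1) * (δ * n) := by
    rw [← Finset.card_powersetCard, ← nsmul_eq_mul]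
    exact Finset.sum_le_card_nsmul _ _ _ fun B hB => hdeg B (Finset.mem_powersetCard.1 hB).2
  have h3 : (Z.card : ℝ) ≤ (#{v ∈ Z | v ∉ A ∧ IsKClique E k (insert v A)} : ℝ) +
      (A.card + ∑ B ∈ Finset.powersetCard (k - 1) A, (#{v : Fin n | insert v B ∉ E} : ℝ)) := by
    exact_mod_cast h1
  linarith

/-- Double counting: if every member of `F` has at least `α * n` one-point extensions in `G`,
then `G` is large. -/
lemma le_card_of_extensions {n j : ℕ} {F G : Finset (Finset (Fin n))} {α : ℝ}
    (hG : ∀ B ∈ G, B.card = j + 1)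
    (hext : ∀ A ∈ F, α * n ≤ (#{v : Fin n | v ∉ A ∧ insert v A ∈ G} : ℝ)) :
    F.card * (α * n) ≤ G.card * (j + 1 : ℝ) := by
  have h1 : #(F.sigma fun A => {v : Fin n | v ∉ A ∧ insert v A ∈ G}) ≤
      #(G.sigma fun B => B) := by
    refine Finset.card_le_card_of_injOn (fun p => ⟨insert p.2 p.1, p.2⟩) ?_ ?_
    · rintro ⟨A, v⟩ h
      simp only [Finset.coe_sigma, Set.mem_sigma_iff, Finset.mem_coe, Finset.mem_filter,
        Finset.mem_univ, true_and] at h ⊢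
      exact ⟨h.2.2, Finset.mem_insert_self _ _⟩
    · rintro ⟨A, v⟩ h ⟨A', v'⟩ h' heq
      simp only [Finset.coe_sigma, Set.mem_sigma_iff, Finset.mem_coe, Finset.mem_filter,
        Finset.mem_univ, true_and] at h h'
      simp only [Sigma.mk.injEq, heq_eq_eq] at heq
      obtain ⟨h1, rfl⟩ := heq
      have := congrArg (fun B => B.erase v) h1
      simp only [Finset.erase_insert h.2.1, Finset.erase_insert h'.2.1] at this
      rw [this]
  rw [Finset.card_sigma, Finset.card_sigma, Finset.sum_congr rfl hG, Finset.sum_const,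
    smul_eq_mul] at h1
  have h2 : ((∑ A ∈ F, #{v : Fin n | v ∉ A ∧ insert v A ∈ G} : ℕ) : ℝ) ≤
      G.card * (j + 1 : ℝ) := by exact_mod_cast h1
  rw [Nat.cast_sum] at h2
  refine le_trans ?_ h2
  rw [← nsmul_eq_mul]
  exact Finset.card_nsmul_le_sum _ _ _ hext

lemma le_card_of_extension_chain {n t : ℕ} (ht : 0 < t) {α : ℝ} (hα : 0 ≤ α)
    (F : ℕ → Finset (Finset (Fin n))) (h0 : ∅ ∈ F 0) (hF : ∀ j, ∀ A ∈ F j, A.card = j)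
    (hext : ∀ j < t, ∀ A ∈ F j, α * n ≤ (#{v : Fin n | v ∉ A ∧ insert v A ∈ F (j + 1)} : ℝ)) :
    ∀ j ≤ t, (α / t * n) ^ j ≤ ((F j).card : ℝ) := by
  intro j
  have ht' : (0 : ℝ) < t := by exact_mod_cast ht
  induction j with
  | zero =>
    intro _
    have : 1 ≤ (F 0).card := Finset.card_pos.2 ⟨_, h0⟩
    simpa using this
  | succ j ih =>
    intro hj
    have h1 := le_card_of_extensions (hF (j + 1)) (hext j hj)
    have h2 := ih (by omega)
    have h3 : (j + 1 : ℝ) ≤ t := by exact_mod_cast hj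
    have h4 : ((F (j + 1)).card : ℝ) * (j + 1 : ℝ) ≤ (F (j + 1)).card * t :=
      mul_le_mul_of_nonneg_left h3 (Nat.cast_nonneg _)
    have h5 : (α / t * n) ^ j * (α * n) ≤ (F j).card * (α * n) :=
      mul_le_mul_of_nonneg_right h2 (by positivity)
    have h6 : (α / t * n) ^ (j + 1) * t = (α / t * n) ^ j * (α * n) := by
      rw [pow_succ]; field_simp
    exact le_of_mul_le_mul_right (by linarith) ht'

open scoped Classical in
/-- There are many `t`-cliques meeting `P` in at least `a` and `Q` in at least `b` vertices. -/
lemma le_card_cliques {n k t a b : ℕ} (hk : 1 ≤ k) (ht : 0 < t) (hab : a + b ≤ t)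
    {E : Finset (Finset (Fin n))} {δ α : ℝ} (hδ : 0 ≤ δ) (hα : 0 ≤ α)
    (hdeg : ∀ T : Finset (Fin n), T.card = k - 1 → (#{v : Fin n | insert v T ∉ E} : ℝ) ≤ δ * n)
    (P Q : Finset (Fin n))
    (hP : α * n + (a - 1).choose (k - 1) * (δ * n) + t ≤ P.card)
    (hQ : α * n + (a + b - 1).choose (k - 1) * (δ * n) + t ≤ Q.card)
    (hn : α * n + (t - 1).choose (k - 1) * (δ * n) + t ≤ n) :
    (α / t * n) ^ t ≤ (#{S : Finset (Fin n) | S.card = t ∧ IsKClique E k S ∧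
      a ≤ (S ∩ P).card ∧ b ≤ (S ∩ Q).card} : ℝ) := by
  let F : ℕ → Finset (Finset (Fin n)) := fun j => {S : Finset (Fin n) | S.card = j ∧
    IsKClique E k S ∧ min j a ≤ (S ∩ P).card ∧ min (j - a) b ≤ (S ∩ Q).card}
  have hδn : 0 ≤ δ * n := mul_nonneg hδ (Nat.cast_nonneg n)
  have step : ∀ (j r : ℕ) (Z A : Finset (Fin n)), j < t → j ≤ r →
      α * n + r.choose (k - 1) * (δ * n) + t ≤ Z.card → A ∈ F j →
      (∀ v ∈ Z, v ∉ A → IsKClique E k (insert v A) → insert v A ∈ F (j + 1)) →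
      α * n ≤ (#{v : Fin n | v ∉ A ∧ insert v A ∈ F (j + 1)} : ℝ) := by
    intro j r Z A hj hr hZ hA hext
    have hA' := (Finset.mem_filter.1 hA).2
    have h1 := le_card_extensions hdeg hA'.2.1 Z
    rw [hA'.1] at h1
    have h2 : ((j.choose (k - 1) : ℕ) : ℝ) ≤ (r.choose (k - 1) : ℕ) := by
      exact_mod_cast Nat.choose_le_choose _ hr
    have h3 := mul_le_mul_of_nonneg_right h2 hδn
    have h4 : (j : ℝ) ≤ t := by exact_mod_cast hj.le
    have h5 : (#{v ∈ Z | v ∉ A ∧ IsKClique E k (insert v A)} : ℝ) ≤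
        (#{v : Fin n | v ∉ A ∧ insert v A ∈ F (j + 1)} : ℝ) := by
      refine Nat.cast_le.2 (Finset.card_le_card fun v hv => ?_)
      rw [Finset.mem_filter] at hv
      exact Finset.mem_filter.2 ⟨Finset.mem_univ _, hv.2.1, hext v hv.1 hv.2.1 hv.2.2⟩
    linarith
  have hinter : ∀ (v : Fin n) (A Z : Finset (Fin n)),
      (A ∩ Z).card ≤ (insert v A ∩ Z).card := fun v A Z =>
    Finset.card_le_card (Finset.inter_subset_inter_right (Finset.subset_insert v A))
  have hinter' : ∀ (v : Fin n) (A Z : Finset (Fin n)), v ∉ A → v ∈ Z →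
      (A ∩ Z).card + 1 ≤ (insert v A ∩ Z).card := fun v A Z hv hvZ => by
    rw [Finset.insert_inter_of_mem hvZ, Finset.card_insert_of_notMem]
    exact fun h => hv (Finset.mem_inter.1 h).1
  have main := le_card_of_extension_chain ht hα F
    (by
      simp only [F, Finset.mem_filter, Finset.mem_univ, true_and]
      refine ⟨rfl, fun e he => ?_, by simp, by simp⟩
      rw [Finset.mem_powersetCard, Finset.subset_empty] at he
      have := he.2
      rw [he.1, Finset.card_empty] at this
      omega)
    (fun j A hA => (Finset.mem_filter.1 hA).2.1)
    (fun j hj A hA => by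
      have hA' := (Finset.mem_filter.1 hA).2
      have hmemF : ∀ v, v ∉ A → IsKClique E k (insert v A) →
          min (j + 1) a ≤ (insert v A ∩ P).card →
          min (j + 1 - a) b ≤ (insert v A ∩ Q).card → insert v A ∈ F (j + 1) := by
        intro v hv hc h1 h2
        refine Finset.mem_filter.2 ⟨Finset.mem_univ _, ?_, hc, h1, h2⟩
        rw [Finset.card_insert_of_notMem hv, hA'.1]
      by_cases h1 : j < a
      · refine step j (a - 1) P A hj (by omega) hP hA fun v hv hvA hc => hmemF v hvA hc ?_ ?_
        · have := hinter' v A P hvA hv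
          have := hA'.2.2.1
          omega
        · omega
      by_cases h2 : j < a + b
      · refine step j (a + b - 1) Q A hj (by omega) hQ hA fun v hv hvA hc => hmemF v hvA hc ?_ ?_
        · have := hinter v A P
          have := hA'.2.2.1
          omega
        · have := hinter' v A Q hvA hv
          have := hA'.2.2.2
          omega
      · refine step j (t - 1) Finset.univ A hj (by omega) (by simpa using hn) hA
          fun v hv hvA hc => hmemF v hvA hc ?_ ?_
        · have := hinter v A P
          have := hA'.2.2.1
          omega
        · have := hinter v A Q
          have := hA'.2.2.2
          omega)
    t le_rfl
  refine main.trans (Nat.cast_le.2 (Finset.card_le_card fun S hS => ?_))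
  simp only [F, Finset.mem_filter, Finset.mem_univ, true_and] at hS ⊢
  exact ⟨hS.1, hS.2.1, by omega, by omega⟩

lemma sum_card_swaps_le {n k t : ℕ} (E : Finset (Finset (Fin n)))
    {X Y : Finset (Fin n)} (F : Finset (Finset (Fin n)))
    (hF : ∀ S ∈ F, S.card = t ∧ IsKClique E k S) :
    ∑ S ∈ F, (swaps E k X Y S).card ≤ 2 * {p : Fin n × Fin n × Finset (Fin n) |
      p.1 ∈ X ∧ p.2.1 ∈ Y ∧ p.2.2.card = t - 1 ∧ p.1 ∉ p.2.2 ∧ p.2.1 ∉ p.2.2 ∧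
      IsKClique E k (insert p.1 p.2.2) ∧ IsKClique E k (insert p.2.1 p.2.2)}.ncard := by
  classical
  rw [← Finset.card_sigma]
  set 𝒯 : Set (Fin n × Fin n × Finset (Fin n)) := {p |
      p.1 ∈ X ∧ p.2.1 ∈ Y ∧ p.2.2.card = t - 1 ∧ p.1 ∉ p.2.2 ∧ p.2.1 ∉ p.2.2 ∧
      IsKClique E k (insert p.1 p.2.2) ∧ IsKClique E k (insert p.2.1 p.2.2)}
  have hex : ∀ q ∈ F.sigma fun S => swaps E k X Y S, ∃ p ∈ 𝒯,
      q = ⟨insert p.2.1 p.2.2, p.1⟩ ∨ q = ⟨insert p.1 p.2.2, p.2.1⟩ := by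
    rintro ⟨S, v⟩ hq
    simp only [Finset.mem_sigma, swaps, Finset.mem_filter, Finset.mem_univ, true_and] at hq
    obtain ⟨hS, hv, u, hu, huv, hc⟩ := hq
    obtain ⟨hcard, hcl⟩ := hF S hS
    have h1 : (S.erase u).card = t - 1 := by rw [Finset.card_erase_of_mem hu, hcard]
    have h2 : v ∉ S.erase u := fun h => hv (Finset.mem_of_mem_erase h)
    have h3 : insert u (S.erase u) = S := Finset.insert_erase hu
    rcases huv with ⟨hvX, huY⟩ | ⟨hvY, huX⟩
    · exact ⟨(v, u, S.erase u), ⟨hvX, huY, h1, h2, Finset.notMem_erase u S, hc,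
        by simpa [h3] using hcl⟩, Or.inl (by simp [h3])⟩
    · exact ⟨(u, v, S.erase u), ⟨huX, hvY, h1, Finset.notMem_erase u S, h2,
        by simpa [h3] using hcl, hc⟩, Or.inr (by simp [h3])⟩
  rcases (F.sigma fun S => swaps E k X Y S).eq_empty_or_nonempty with h | ⟨q₀, hq₀⟩
  · rw [h, Finset.card_empty]
    exact Nat.zero_le _
  have : Nonempty (Fin n × Fin n × Finset (Fin n)) := (hex q₀ hq₀).nonempty
  choose! f hf hf' using hex
  rw [Set.ncard_eq_toFinset_card 𝒯 (Set.toFinite 𝒯)]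
  have hmaps : ∀ q ∈ F.sigma fun S => swaps E k X Y S, f q ∈ (Set.toFinite 𝒯).toFinset :=
    fun q hq => (Set.Finite.mem_toFinset _).2 (hf q hq)
  refine Finset.card_le_mul_card_image_of_maps_to hmaps 2 fun p _ => ?_
  refine (Finset.card_le_card (t := {⟨insert p.2.1 p.2.2, p.1⟩, ⟨insert p.1 p.2.2, p.2.1⟩})
    fun q hq => ?_).trans Finset.card_le_two
  rw [Finset.mem_filter] at hq
  have := hf' q hq.1
  rw [hq.2] at this
  simpa using this

lemma goodL_zero {k t : ℕ} (hk : 3 ≤ k) (hkt : k < t) : GoodL k t 0 := by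
  have h0 : (0 : ℕ).choose (k - 1) = 0 := Nat.choose_eq_zero_of_lt (by omega)
  have h1 : (1 : ℕ).choose (k - 1) = 0 := Nat.choose_eq_zero_of_lt (by omega)
  have hpos : (0 : ℝ) < (t - 1).choose (k - 1) := by
    exact_mod_cast Nat.choose_pos (by omega : k - 1 ≤ t - 1)
  have hle : ((t - 1).choose (k - 1) : ℝ) ≤ t.choose (k - 1) := by
    exact_mod_cast Nat.choose_le_choose _ (Nat.sub_le t 1)
  refine ⟨by omega, ?_, fun h => absurd h (by simp [h1])⟩
  simp only [betaL, h0, h1, Nat.sub_zero, zero_add, Nat.cast_zero, add_zero]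
  rw [div_le_div_iff₀ (by linarith) hpos]
  linarith

lemma goodL_l0 {k t : ℕ} (hk : 4 ≤ k) (hkt : k < t) : GoodL k t (l0 k t) := by
  rw [l0, if_neg (by omega)]
  exact Nat.sSup_mem (s := {l | GoodL k t l}) ⟨0, goodL_zero (by omega) hkt⟩ ⟨t, fun l hl => by
    have := hl.1
    omega⟩

lemma goodL_one {t : ℕ} (ht : 5 ≤ t) : GoodL 3 t 1 := by
  obtain ⟨s, rfl⟩ : ∃ s, t = s + 5 := ⟨t - 5, by omega⟩
  have h5 : ((s + 5).choose 2 : ℝ) = (s + 5) * (s + 4) / 2 := by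
    rw [Nat.cast_choose_two]; push_cast; ring
  have h4 : ((s + 4).choose 2 : ℝ) = (s + 4) * (s + 3) / 2 := by
    rw [Nat.cast_choose_two]; push_cast; ring
  have h3 : ((s + 3).choose 2 : ℝ) = (s + 3) * (s + 2) / 2 := by
    rw [Nat.cast_choose_two]; push_cast; ring
  have hs : (0 : ℝ) ≤ s := Nat.cast_nonneg s
  refine ⟨by omega, ?_, fun _ => ?_⟩
  · simp only [betaL, show s + 4 - 1 = s + 3 by omega, show s + 5 - 1 = s + 4 by omega,
      show 3 - 1 = 2 by omega, h5, h4, h3]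
    norm_num
    rw [div_le_div_iff₀ (by positivity) (by positivity)]
    nlinarith
  · simp only [betaL, show s + 4 - 1 = s + 3 by omega, show s + 5 - 1 = s + 4 by omega,
      show 3 - 1 = 2 by omega, h5, h3, show Nat.choose (2 * 1 + 1) 2 = 3 from rfl]
    norm_num
    rw [div_le_div_iff₀ (by positivity) (by positivity)]
    nlinarith

lemma betaKT_three_four : betaKT 3 4 = 1 / 4 := by
  norm_num [betaKT, l0, betaL, Nat.choose]

lemma dKT_three_four : dKT 3 4 = 1 / 4 := by
  rw [dKT, betaKT_three_four]
  norm_num [Nat.choose]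

lemma goodL_l0_or {k t : ℕ} (hk : 3 ≤ k) (hkt : k < t) :
    (k = 3 ∧ t = 4) ∨ GoodL k t (l0 k t) := by
  rcases hk.eq_or_lt with rfl | hk
  · rcases (show 4 ≤ t by omega).eq_or_lt with rfl | ht
    · exact Or.inl ⟨rfl, rfl⟩
    · right
      rw [l0, if_pos rfl]
      exact goodL_one ht
  · exact Or.inr (goodL_l0 hk hkt)

open scoped Classical in
lemma le_card_swappable_three_four {n : ℕ} {γ : ℝ} (hγ : 0 < γ) (hγβ : γ < 1 / 4)
    (hn : 4 ≤ γ / 4 * n) {E : Finset (Finset (Fin n))}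
    (hdeg : ∀ T : Finset (Fin n), T.card = 3 - 1 →
      (#{v : Fin n | insert v T ∉ E} : ℝ) ≤ (1 / 4 - γ) * n)
    {X Y : Finset (Fin n)} (hXY : Disjoint X Y) (hun : X ∪ Y = Finset.univ)
    (hX : (n : ℝ) ≤ 2 * X.card) (hY : (1 / 4 + γ) * n ≤ (Y.card : ℝ)) :
    (γ / 4 / (4 : ℕ) * n) ^ 4 ≤ (#{S : Finset (Fin n) | S.card = 4 ∧ IsKClique E 3 S ∧
      γ / 4 * n ≤ (swaps E 3 X Y S).card} : ℝ) := by
  have hn0 : (0 : ℝ) ≤ n := Nat.cast_nonneg n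
  have hγn : 0 ≤ γ * n := by positivity
  refine (le_card_cliques (k := 3) (t := 4) (a := 2) (b := 1) (by norm_num) (by norm_num)
    (by norm_num) (sub_nonneg.2 hγβ.le) (by positivity) hdeg Y X ?_ ?_ ?_).trans
    (Nat.cast_le.2 (Finset.card_le_card fun S hS => ?_))
  · norm_num [Nat.choose]
    linarith
  · norm_num [Nat.choose]
    linarith
  · norm_num [Nat.choose]
    linarith
  · simp only [Finset.mem_filter, Finset.mem_univ, true_and] at hS ⊢
    obtain ⟨hcard, hcl, hSY, hSX⟩ := hS
    refine ⟨hcard, hcl, ?_⟩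
    rcases hSX.eq_or_lt with h | h
    · rw [swaps_comm]
      have := le_card_swaps_of_inter_eq_one hdeg (by rwa [Finset.union_comm]) hcl hcard
        (Finset.card_pos.1 (by omega)) h.symm
      linarith
    · have := le_card_swaps_of_balanced (sub_nonneg.2 hγβ.le) hdeg hXY hun hcl
        (m := 2) (by norm_num) h hSY
      norm_num [hcard, Nat.choose] at this
      linarith

open scoped Classical in
/-- In a `k`-graph of large minimum codegree many `t`-cliques have linearly many swaps. -/
lemma le_card_swappable {n k t : ℕ} (hk : 3 ≤ k) (hkt : k < t) {γ : ℝ} (hγ : 0 < γ)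
    (hγβ : γ < betaKT k t) (hn : t ≤ γ / 4 * n) {E : Finset (Finset (Fin n))}
    (hdeg : ∀ T : Finset (Fin n), T.card = k - 1 →
      (#{v : Fin n | insert v T ∉ E} : ℝ) ≤ (betaKT k t - γ) * n)
    {X Y : Finset (Fin n)} (hXY : Disjoint X Y) (hun : X ∪ Y = Finset.univ)
    (hX : (n : ℝ) ≤ 2 * X.card) (hY : (dKT k t + γ) * n ≤ (Y.card : ℝ)) :
    (γ / 4 / t * n) ^ t ≤ (#{S : Finset (Fin n) | S.card = t ∧ IsKClique E k S ∧
      γ / 4 * n ≤ (swaps E k X Y S).card} : ℝ) := by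
  rcases goodL_l0_or hk hkt with ⟨rfl, rfl⟩ | ⟨h2l, hβ1, hβ2⟩
  · rw [betaKT_three_four] at hγβ hdeg
    rw [dKT_three_four] at hY
    exact le_card_swappable_three_four hγ hγβ (by exact_mod_cast hn) hdeg hXY hun hX hY
  change betaKT k t ≤ _ at hβ1
  change _ → betaKT k t ≤ _ at hβ2
  have hβ : betaKT k t = betaL k t (l0 k t) := rfl
  rw [betaL] at hβ
  rw [dKT] at hY
  set β := betaKT k t
  set l := l0 k t
  have hn0 : (0 : ℝ) ≤ n := Nat.cast_nonneg n
  have hγn : 0 ≤ γ * n := by positivity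
  have hc1 : (1 : ℝ) ≤ (t - 1).choose (k - 1) := by
    exact_mod_cast Nat.choose_pos (by omega : k - 1 ≤ t - 1)
  have hcl : (0 : ℝ) ≤ l.choose (k - 1) := Nat.cast_nonneg _
  have hβ0 : 0 < β := hγ.trans hγβ
  rw [le_div_iff₀ (by linarith)] at hβ1
  have hβ_le : β ≤ 1 := by nlinarith
  have hδ : 0 ≤ β - γ := sub_nonneg.2 hγβ.le
  have hγn' : γ * n ≤ n := by nlinarith
  have hβn : (β * ((t - 1).choose (k - 1) + l.choose (k - 1))) * n ≤ 1 * n :=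
    mul_le_mul_of_nonneg_right hβ1 hn0
  have hcγ : γ * n ≤ (t - 1).choose (k - 1) * (γ * n) := le_mul_of_one_le_left hγn hc1
  have hclγ : 0 ≤ l.choose (k - 1) * (γ * n) := mul_nonneg hcl hγn
  have hclβ : 0 ≤ l.choose (k - 1) * (β * n) := by positivity
  refine (le_card_cliques (k := k) (t := t) (a := l + 1) (b := l + 1) (by omega) (by omega)
    (by omega) hδ (by positivity) hdeg Y X ?_ ?_ ?_).trans
    (Nat.cast_le.2 (Finset.card_le_card fun S hS => ?_))
  · rw [Nat.add_sub_cancel]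
    linarith
  · rw [show l + 1 + (l + 1) - 1 = 2 * l + 1 by omega]
    rcases Nat.eq_zero_or_pos ((2 * l + 1).choose (k - 1)) with h | h
    · rw [h, Nat.cast_zero, zero_mul]
      linarith
    · have h1 := hβ2 h
      have h2 : (1 : ℝ) ≤ (2 * l + 1).choose (k - 1) := by exact_mod_cast h
      rw [le_div_iff₀ (by linarith)] at h1
      have h3 := mul_le_mul_of_nonneg_right h1 hn0
      have h4 : γ * n ≤ (2 * l + 1).choose (k - 1) * (γ * n) := le_mul_of_one_le_left hγn h2
      linarith
  · linarith
  · simp only [Finset.mem_filter, Finset.mem_univ, true_and] at hS ⊢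
    obtain ⟨hcard, hcl, hSY, hSX⟩ := hS
    refine ⟨hcard, hcl, ?_⟩
    have h1 := le_card_swaps_of_balanced hδ hdeg hXY hun hcl (m := l + 1) (by omega) hSX hSY
    rw [hcard, ← Nat.sub_sub t l 1] at h1
    set W : ℝ := (t.choose (k - 1) : ℝ) + ((t - l - 1).choose (k - 1) : ℝ) +
      ((l + 1).choose (k - 1) : ℝ)
    have hW0 : 0 ≤ W := by positivity
    have hW : β * W = 2 := by
      rw [hβ, div_mul_cancel₀]
      rintro h0
      rw [h0, div_zero] at hβ
      exact hβ0.ne' hβ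
    have h2W : 2 ≤ W := by nlinarith
    have h3 : γ * n * 2 ≤ γ * n * W := mul_le_mul_of_nonneg_left h2W hγn
    have h4 : (β - γ) * n * W = 2 * n - γ * n * W := by
      rw [← hW]; ring
    linarith

/-- Connecting lemma: given a partition `X ∪ Y` of the vertex set into two large parts,
there are many triples `(x, y, T)` with `x ∈ X`, `y ∈ Y` such that both `T ∪ {x}` and
`T ∪ {y}` form copies of `K_t^k`. -/
theorem connecting_triples (k t : ℕ) (hk : 3 ≤ k) (hkt : k < t) (γ : ℝ)
    (hγ : 0 < γ) (hγβ : γ < betaKT k t) :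
    ∃ n₀ : ℕ, ∃ ε₀ : ℝ, 0 < ε₀ ∧ ∀ n : ℕ, n₀ ≤ n →
      ∀ E : Finset (Finset (Fin n)), (∀ e ∈ E, e.card = k) →
      (∀ T : Finset (Fin n), T.card = k - 1 →
        (1 - betaKT k t + γ) * n ≤ (degOn E k T : ℝ)) →
      ∀ X Y : Finset (Fin n), Disjoint X Y → X ∪ Y = Finset.univ →
      (dKT k t + γ) * n ≤ (X.card : ℝ) → (dKT k t + γ) * n ≤ (Y.card : ℝ) →
      ε₀ * (n : ℝ) ^ (t + 1) ≤
        (({p : Fin n × Fin n × Finset (Fin n) |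
            p.1 ∈ X ∧ p.2.1 ∈ Y ∧ p.2.2.card = t - 1 ∧ p.1 ∉ p.2.2 ∧ p.2.1 ∉ p.2.2 ∧
            IsKClique E k (insert p.1 p.2.2) ∧
            IsKClique E k (insert p.2.1 p.2.2)}).ncard : ℝ) := by
  have ht0 : (0 : ℝ) < t := by exact_mod_cast (by omega : 0 < t)
  refine ⟨⌈4 * t / γ⌉₊, (γ / 4 / t) ^ t * (γ / 4) / 2, by positivity, ?_⟩
  intro n hn E _ hdeg X Y hXY hun hX hY
  have hn' : (t : ℝ) ≤ γ / 4 * n := by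
    have := Nat.ceil_le.1 hn
    rw [div_le_iff₀ hγ] at this
    linarith
  have hdeg' : ∀ T : Finset (Fin n), T.card = k - 1 →
      (#{v : Fin n | insert v T ∉ E} : ℝ) ≤ (betaKT k t - γ) * n := by
    intro T hT
    have h1 := hdeg T hT
    have h2 : (#{v : Fin n | insert v T ∉ E} : ℝ) + degOn E k T ≤ n := by
      exact_mod_cast card_nonneighbors_add_degOn_le (by omega) E T hT
    linarith
  classical
  have hmany : (γ / 4 / t * n) ^ t ≤ (#{S : Finset (Fin n) | S.card = t ∧ IsKClique E k S ∧
      γ / 4 * n ≤ (swaps E k X Y S).card} : ℝ) := by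
    have hcard : (X.card : ℝ) + Y.card = n := by
      rw [← Nat.cast_add, ← Finset.card_union_of_disjoint hXY, hun, Finset.card_univ,
        Fintype.card_fin]
    rcases le_total (Y.card : ℝ) X.card with h | h
    · exact le_card_swappable hk hkt hγ hγβ hn' hdeg' hXY hun (by linarith) hY
    · simp_rw [swaps_comm E k X Y]
      exact le_card_swappable hk hkt hγ hγβ hn' hdeg' hXY.symm
        (by rwa [Finset.union_comm]) (by linarith) hX
  set F : Finset (Finset (Fin n)) := {S | S.card = t ∧ IsKClique E k S ∧
      γ / 4 * n ≤ (swaps E k X Y S).card}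
  have hF : ∀ S ∈ F, S.card = t ∧ IsKClique E k S ∧ γ / 4 * n ≤ (swaps E k X Y S).card :=
    fun S hS => (Finset.mem_filter.1 hS).2
  have h1 := sum_card_swaps_le E (X := X) (Y := Y) F fun S hS => ⟨(hF S hS).1, (hF S hS).2.1⟩
  have h2 : F.card * (γ / 4 * n) ≤ ∑ S ∈ F, ((swaps E k X Y S).card : ℝ) := by
    rw [← nsmul_eq_mul]
    exact Finset.card_nsmul_le_sum _ _ _ fun S hS => (hF S hS).2.2
  have h3 : (γ / 4 / t * n) ^ t * (γ / 4 * n) ≤ F.card * (γ / 4 * n) :=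
    mul_le_mul_of_nonneg_right hmany (by positivity)
  have h4 := (Nat.cast_le (α := ℝ)).2 h1
  rw [Nat.cast_sum, Nat.cast_mul, Nat.cast_two] at h4
  have h5 : (γ / 4 / t) ^ t * (γ / 4) / 2 * (n : ℝ) ^ (t + 1) =
      (γ / 4 / t * n) ^ t * (γ / 4 * n) / 2 := by
    rw [mul_pow]; ring
  rw [h5, div_le_iff₀ two_pos, mul_comm _ (2 : ℝ)]
  exact h3.trans (h2.trans h4)
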